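/- Let x be a separated vector in the James Tree space JT such that supp(x) ⊆ F ∪ σ, where F is a finite set of nodes of T and σ is a branch of T. Then x is an extreme point of the ball of radius ‖x‖_{JT}. -/

import Mathlib

/-! Common framework for the James Tree space `JT`.

The dyadic tree is modelled as `List Bool`, ordered by `List.IsPrefix` (`<+:`). -/

abbrev DyadicNode := List Bool

namespace JTSpace

/-- A segment of the dyadic tree: a linearly ordered, order-convex subset. -/
def IsSegment (S : Set DyadicNode) : Prop :=
  (∀ a ∈ S, ∀ b ∈ S, a <+: b ∨ b <+: a) ∧
  (∀ a ∈ S, ∀ b ∈ S, ∀ c : DyadicNode, a <+: c → c <+: b → c ∈ S)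

/-- A partition: a family of pairwise disjoint segments. -/
def IsPartition (P : Set (Set DyadicNode)) : Prop :=
  (∀ S ∈ P, IsSegment S) ∧ P.PairwiseDisjoint id

/-- The sum of `x` along a set of nodes. -/
noncomputable def segSum (x : DyadicNode → ℝ) (S : Set DyadicNode) : ℝ :=
  ∑' a : S, x a

/-- The square of the value `‖x‖_P` of `x` on the partition `P`. -/
noncomputable def pNormSq (x : DyadicNode → ℝ) (P : Set (Set DyadicNode)) : ℝ :=
  ∑' S : P, (segSum x S) ^ 2

/-- The set of all values `‖x‖_P²` over partitions `P`. -/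
def normSqSet (x : DyadicNode → ℝ) : Set ℝ :=
  {r | ∃ P, IsPartition P ∧ r = pNormSq x P}

/-- The square of the `JT` norm. -/
noncomputable def JTnormSq (x : DyadicNode → ℝ) : ℝ := sSup (normSqSet x)

/-- The `JT` norm of `x`. -/
noncomputable def JTnorm (x : DyadicNode → ℝ) : ℝ := Real.sqrt (JTnormSq x)

/-- The `ℓ₂` norm of `x`. -/
noncomputable def l2norm (x : DyadicNode → ℝ) : ℝ := Real.sqrt (∑' a, (x a) ^ 2)

def HasBddNorm (x : DyadicNode → ℝ) : Prop := BddAbove (normSqSet x)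

/-- `x` belongs to the James Tree space: its norm is finite and it is approximable in the
`JT` norm by finitely supported functions (`JT` is the completion of `c₀₀(T)`). -/
def MemJT (x : DyadicNode → ℝ) : Prop :=
  HasBddNorm x ∧
  ∀ ε > (0 : ℝ), ∃ y : DyadicNode → ℝ, (Function.support y).Finite ∧
    HasBddNorm (x - y) ∧ JTnorm (x - y) ≤ ε

/-- An `x`-norming partition. -/
def IsNormingPartition (x : DyadicNode → ℝ) (P : Set (Set DyadicNode)) : Prop :=
  IsPartition P ∧ pNormSq x P = JTnormSq x

/-- A complete subtree of the dyadic tree. -/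
def IsCompleteSubtree (K : Set DyadicNode) : Prop :=
  ∀ a ∈ K, ∀ b ∈ K, ∀ c : DyadicNode, a <+: c → c <+: b → c ∈ K

/-- The range of `x`: the smallest complete subtree containing the support of `x`. -/
def ran (x : DyadicNode → ℝ) : Set DyadicNode :=
  ⋂₀ {K | IsCompleteSubtree K ∧ Function.support x ⊆ K}

/-- `x` is separated: every two distinct nodes of `ran x` are separated by some
`x`-norming partition. -/
def Separated (x : DyadicNode → ℝ) : Prop :=
  ∀ a ∈ ran x, ∀ b ∈ ran x, a ≠ b →
    ∃ P, IsNormingPartition x P ∧ ∃ S ∈ P, ∃ S' ∈ P, S ≠ S' ∧ a ∈ S ∧ b ∈ S'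

/-- `x` is an extreme point of the ball of radius `‖x‖_{JT}`. -/
def IsExtremePoint (x : DyadicNode → ℝ) : Prop :=
  x ≠ 0 ∧
  ∀ y z : DyadicNode → ℝ, MemJT y → MemJT z →
    ∀ l : ℝ, 0 < l → l < 1 → x = l • y + (1 - l) • z →
      JTnorm y = JTnorm x → JTnorm z = JTnorm x → y = x ∧ z = x

/-- A branch: a maximal segment. -/
def IsBranch (b : Set DyadicNode) : Prop :=
  IsSegment b ∧ ∀ S : Set DyadicNode, IsSegment S → b ⊆ S → S = b

/-- The wedge rooted at `a`. -/
def wedge (a : DyadicNode) : Set DyadicNode := {b | a <+: b}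

/-- The two children of a node. -/
def children (u : DyadicNode) : Set DyadicNode := {u ++ [false], u ++ [true]}

/-- The maximal segment sum starting at `a`:
`S_a(x) = sup { S_s(x) : s a segment with min s = a }`. -/
noncomputable def maxSum (x : DyadicNode → ℝ) (a : DyadicNode) : ℝ :=
  sSup {r | ∃ s : Set DyadicNode, IsSegment s ∧ a ∈ s ∧ (∀ b ∈ s, a <+: b) ∧ r = segSum x s}

/-- The children of `u` within the subtree spanned by the support of `x`. -/
def supportedChildren (x : DyadicNode → ℝ) (u : DyadicNode) : Set DyadicNode :=
  {c ∈ children u | ∃ b ∈ Function.support x, c <+: b}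

/-- A greedy partition for a positive vector `x`: a partition whose segments cover the
support of `x` and such that every segment, at every support node `u` which has a strict
descendant in the support, continues through a child of `u` (within the subtree spanned by
the support) maximizing the maximal segment sum, down to the next element of the support;
at support nodes with no strict descendant in the support, the segment's support ends. -/
def IsGreedyPartition (x : DyadicNode → ℝ) (P : Set (Set DyadicNode)) : Prop :=
  IsPartition P ∧ Function.support x ⊆ ⋃₀ P ∧
  ∀ s ∈ P, ∀ u ∈ s ∩ Function.support x,
    ((∃ w ∈ Function.support x, u <+: w ∧ u ≠ w) →
      ∃ v ∈ s ∩ Function.support x, u <+: v ∧ u ≠ v ∧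
        (∀ w ∈ s ∩ Function.support x, u <+: w → u ≠ w → v <+: w) ∧
        ∃ c ∈ supportedChildren x u, c <+: v ∧
          ∀ k ∈ supportedChildren x u, maxSum x k ≤ maxSum x c) ∧
    ((¬ ∃ w ∈ Function.support x, u <+: w ∧ u ≠ w) →
      ∀ w ∈ s ∩ Function.support x, w <+: u)


open Classical in
/-- Finite indexed families of disjoint finite segments are dominated by the norm. -/
lemma finite_family_le {ι : Type*} (y : DyadicNode → ℝ) (hy : HasBddNorm y)
    (I : Finset ι) (f : ι → Finset DyadicNode)
    (hseg : ∀ i ∈ I, IsSegment (f i : Set DyadicNode))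
    (hd : (I : Set ι).PairwiseDisjoint f) :
    ∑ i ∈ I, (∑ a ∈ f i, y a) ^ 2 ≤ JTnormSq y := by
  have hmem : ∑ i ∈ I, (∑ a ∈ f i, y a) ^ 2 ∈ normSqSet y := by
    let P : Finset (Set DyadicNode) := (I.image f).image (fun s : Finset DyadicNode => (s : Set DyadicNode))
    refine ⟨(P : Set (Set DyadicNode)), ⟨?_, ?_⟩, ?_⟩
    · intro S hS
      simp only [P, Finset.mem_coe, Finset.mem_image] at hS
      obtain ⟨s, ⟨i, hi, rfl⟩, rfl⟩ := hS
      exact hseg i hi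
    · intro S hS S' hS' hne
      simp only [P, Finset.mem_coe, Finset.mem_image] at hS hS'
      obtain ⟨s, ⟨i, hi, rfl⟩, rfl⟩ := hS
      obtain ⟨s', ⟨j, hj, rfl⟩, rfl⟩ := hS'
      have hij : i ≠ j := by
        rintro rfl; exact hne rfl
      have := hd hi hj hij
      simpa [Function.onFun, Finset.disjoint_coe] using this
    · unfold pNormSq
      have h1 : ∑' S : (P : Set (Set DyadicNode)), (segSum y S) ^ 2 = ∑ S ∈ P, (segSum y S) ^ 2 :=
        Finset.tsum_subtype' P (fun S => (segSum y S) ^ 2)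
      rw [h1]
      simp only [P]
      rw [Finset.sum_image (by intro a _ b _ h; exact Finset.coe_injective h)]
      rw [Finset.sum_image_of_disjoint (f := f) (by simp [segSum]) hd]
      refine Finset.sum_congr rfl fun i _ => ?_
      congr 1
      exact (Finset.tsum_subtype' (f i) y).symm
  exact le_csSup hy hmem

open Classical in
lemma finite_family_insert_le {ι : Type*} (y : DyadicNode → ℝ) (hy : HasBddNorm y)
    (I : Finset ι) (f : ι → Finset DyadicNode) (S : Finset DyadicNode)
    (hseg : ∀ i ∈ I, IsSegment (f i : Set DyadicNode)) (hS : IsSegment (S : Set DyadicNode))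
    (hd : (I : Set ι).PairwiseDisjoint f) (hdS : ∀ i ∈ I, Disjoint (f i) S) :
    ∑ i ∈ I, (∑ a ∈ f i, y a) ^ 2 + (∑ a ∈ S, y a) ^ 2 ≤ JTnormSq y := by
  have := finite_family_le y hy (Finset.insertNone I) (fun o => o.elim S f) ?_ ?_
  · rw [Finset.sum_insertNone] at this
    simp only [Option.elim] at this
    linarith
  · intro o ho
    cases o with
    | none => exact hS
    | some i => exact hseg i (by simpa using ho)
  · intro o ho o' ho' hne
    cases o with
    | none =>
      cases o' with
      | none => exact absurd rfl hne
      | some j => exact (hdS j (by simpa using ho')).symm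
    | some i =>
      cases o' with
      | none => exact hdS i (by simpa using ho)
      | some j => exact hd (by simpa using ho) (by simpa using ho') (by simpa using hne)

/-- A finite segment which occurs in almost norming finite families. -/
def Good (x : DyadicNode → ℝ) (S : Finset DyadicNode) : Prop :=
  IsSegment (S : Set DyadicNode) ∧ ∀ ε > (0 : ℝ), ∃ (I : Finset (Set DyadicNode))
    (f : Set DyadicNode → Finset DyadicNode),
    (∀ i ∈ I, IsSegment (f i : Set DyadicNode)) ∧
    (I : Set (Set DyadicNode)).PairwiseDisjoint f ∧ (∀ i ∈ I, Disjoint (f i) S) ∧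
    JTnormSq x - ε ≤ ∑ i ∈ I, (∑ a ∈ f i, x a) ^ 2 + (∑ a ∈ S, x a) ^ 2

lemma Good.sum_eq_zero {x y z : DyadicNode → ℝ} {S : Finset DyadicNode} (h : Good x S)
    (hy : HasBddNorm y) (hz : HasBddNorm z) {l : ℝ} (hl0 : 0 < l) (hl1 : l < 1)
    (hxyz : x = l • y + (1 - l) • z) (hyx : JTnormSq y = JTnormSq x)
    (hzx : JTnormSq z = JTnormSq x) : ∑ a ∈ S, (y a - z a) = 0 := by
  have hsum : ∀ A : Finset DyadicNode, ∑ a ∈ A, x a = l * ∑ a ∈ A, y a + (1 - l) * ∑ a ∈ A, z a := by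
    intro A
    rw [Finset.mul_sum, Finset.mul_sum, ← Finset.sum_add_distrib, hxyz]
    simp
  have hle : ∀ A : Finset DyadicNode, (∑ a ∈ A, x a) ^ 2 ≤
      l * (∑ a ∈ A, y a) ^ 2 + (1 - l) * (∑ a ∈ A, z a) ^ 2 := by
    intro A
    rw [hsum]
    nlinarith [mul_nonneg (mul_nonneg hl0.le (sub_nonneg.2 hl1.le))
      (sq_nonneg (∑ a ∈ A, y a - ∑ a ∈ A, z a))]
  rw [Finset.sum_sub_distrib]
  have key : l * (1 - l) * (∑ a ∈ S, y a - ∑ a ∈ S, z a) ^ 2 ≤ 0 := by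
    refine le_of_forall_pos_le_add fun ε hε => ?_
    obtain ⟨I, f, hseg, hd, hdS, hN⟩ := h.2 ε hε
    have hY := finite_family_insert_le y hy I f S hseg h.1 hd hdS
    have hZ := finite_family_insert_le z hz I f S hseg h.1 hd hdS
    have h1 : ∑ i ∈ I, (∑ a ∈ f i, x a) ^ 2 ≤
        l * ∑ i ∈ I, (∑ a ∈ f i, y a) ^ 2 + (1 - l) * ∑ i ∈ I, (∑ a ∈ f i, z a) ^ 2 := by
      rw [Finset.mul_sum, Finset.mul_sum, ← Finset.sum_add_distrib]
      exact Finset.sum_le_sum fun i _ => hle (f i)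
    rw [hyx] at hY
    rw [hzx] at hZ
    rw [hsum S] at hN
    have h2 := mul_le_mul_of_nonneg_left hY hl0.le
    have h3 := mul_le_mul_of_nonneg_left hZ (sub_nonneg.2 hl1.le)
    nlinarith
  have h0 : 0 < l * (1 - l) := mul_pos hl0 (sub_pos.2 hl1)
  have : (∑ a ∈ S, y a - ∑ a ∈ S, z a) ^ 2 ≤ 0 := by
    by_contra hc
    push Not at hc
    nlinarith [mul_pos h0 hc]
  exact pow_eq_zero_iff (two_ne_zero) |>.1 (le_antisymm this (sq_nonneg _))

/-- Nodes of length less than `n`. -/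
noncomputable def lev (n : ℕ) : Finset DyadicNode := (List.finite_length_lt Bool n).toFinset

lemma mem_lev {n : ℕ} {a : DyadicNode} : a ∈ lev n ↔ a.length < n := by
  simp [lev]

lemma tendsto_lev : Filter.Tendsto lev Filter.atTop Filter.atTop := by
  refine Filter.tendsto_atTop_finset_of_monotone ?_ ?_
  · intro m n h a ha
    rw [mem_lev] at *
    omega
  · intro a
    exact ⟨a.length + 1, by rw [mem_lev]; omega⟩

open Classical in
/-- Truncation of a segment. -/
noncomputable def trunc (R : Set DyadicNode) (n : ℕ) (S : Set DyadicNode) : Finset DyadicNode :=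
  (lev n).filter (fun a => a ∈ S ∧ a ∈ R)

lemma mem_trunc {R S : Set DyadicNode} {n : ℕ} {a : DyadicNode} :
    a ∈ trunc R n S ↔ a.length < n ∧ a ∈ S ∧ a ∈ R := by
  simp [trunc, mem_lev]

lemma trunc_segment {R S : Set DyadicNode} (hR : IsCompleteSubtree R) (hS : IsSegment S) (n : ℕ) :
    IsSegment (trunc R n S : Set DyadicNode) := by
  constructor
  · intro a ha b hb
    simp only [Finset.mem_coe, mem_trunc] at ha hb
    exact hS.1 a ha.2.1 b hb.2.1
  · intro a ha b hb c hac hcb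
    simp only [Finset.mem_coe, mem_trunc] at *
    exact ⟨lt_of_le_of_lt hcb.length_le hb.1, hS.2 a ha.2.1 b hb.2.1 c hac hcb,
      hR a ha.2.2 b hb.2.2 c hac hcb⟩

lemma trunc_disjoint {R S S' : Set DyadicNode} (h : Disjoint S S') (n : ℕ) :
    Disjoint (trunc R n S) (trunc R n S') := by
  rw [Finset.disjoint_left]
  intro a ha ha'
  rw [mem_trunc] at ha ha'
  exact Set.disjoint_left.1 h ha.2.1 ha'.2.1

lemma trunc_eventually (x : DyadicNode → ℝ) {R : Set DyadicNode} (hsR : Function.support x ⊆ R)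
    (S : Set DyadicNode) {ε : ℝ} (hε : 0 < ε) :
    ∀ᶠ n in Filter.atTop, (segSum x S) ^ 2 - ε ≤ (∑ a ∈ trunc R n S, x a) ^ 2 := by
  by_cases hs : Summable (S.indicator x)
  · have h1 : segSum x S = ∑' a, S.indicator x a := tsum_subtype S x
    have h2 : Filter.Tendsto (fun n => ∑ a ∈ lev n, S.indicator x a) Filter.atTop
        (nhds (segSum x S)) := by
      rw [h1]
      exact hs.hasSum.comp tendsto_lev
    have h3 : ∀ n, ∑ a ∈ lev n, S.indicator x a = ∑ a ∈ trunc R n S, x a := by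
      intro n
      rw [trunc, Finset.sum_filter]
      refine Finset.sum_congr rfl fun a _ => ?_
      by_cases haS : a ∈ S
      · by_cases haR : a ∈ R
        · simp [haS, haR]
        · have : x a = 0 := by
            by_contra hc
            exact haR (hsR hc)
          simp [haS, this]
      · simp [haS]
    simp only [h3] at h2
    have h4 := (h2.pow 2).eventually_const_le (u := (segSum x S) ^ 2 - ε) (by linarith)
    exact h4
  · have h1 : segSum x S = 0 := by
      have : segSum x S = ∑' a, S.indicator x a := tsum_subtype S x
      rw [this]
      exact tsum_eq_zero_of_not_summable hs
    refine Filter.Eventually.of_forall fun n => ?_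
    rw [h1]
    nlinarith [sq_nonneg (∑ a ∈ trunc R n S, x a)]

lemma approx (x : DyadicNode → ℝ) {R : Set DyadicNode} (hsR : Function.support x ⊆ R)
    (hN : 0 < JTnormSq x) {P : Set (Set DyadicNode)} (hP : IsNormingPartition x P)
    {ε : ℝ} (hε : 0 < ε) :
    ∃ I : Finset (Set DyadicNode), (∀ S ∈ I, S ∈ P) ∧ ∀ᶠ n in Filter.atTop,
      JTnormSq x - ε ≤ ∑ S ∈ I, (∑ a ∈ trunc R n S, x a) ^ 2 := by
  have hs : Summable (fun S : P => (segSum x S) ^ 2) := by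
    by_contra hc
    have := tsum_eq_zero_of_not_summable hc
    have h2 := hP.2
    unfold pNormSq at h2
    linarith
  have ht := hs.hasSum.eventually_const_le (u := JTnormSq x - ε / 2)
    (by have h2 := hP.2; unfold pNormSq at h2; rw [h2]; linarith)
  obtain ⟨J, hJ⟩ := ht.exists
  refine ⟨J.map (Function.Embedding.subtype _), ?_, ?_⟩
  · intro S hS
    simp only [Finset.mem_map, Function.Embedding.coe_subtype] at hS
    obtain ⟨a, _, rfl⟩ := hS
    exact a.2
  · have hpos : 0 < ε / 2 / (J.card + 1) := by positivity
    have hev : ∀ᶠ n in Filter.atTop, ∀ S ∈ J,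
        (segSum x S) ^ 2 - ε / 2 / (J.card + 1) ≤ (∑ a ∈ trunc R n (S : Set DyadicNode), x a) ^ 2 :=
      (Finset.eventually_all J).2 fun S _ => trunc_eventually x hsR S hpos
    filter_upwards [hev] with n hn
    rw [Finset.sum_map]
    simp only [Function.Embedding.coe_subtype]
    have := Finset.sum_le_sum hn
    rw [Finset.sum_sub_distrib, Finset.sum_const, nsmul_eq_mul] at this
    have h5 : (J.card : ℝ) * (ε / 2 / (J.card + 1)) ≤ ε / 2 := by
      rw [mul_div_assoc', div_le_iff₀ (by positivity)]
      nlinarith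
    linarith

open Classical in
lemma good_of_mem (x : DyadicNode → ℝ) {R : Set DyadicNode} (hR : IsCompleteSubtree R)
    (hsR : Function.support x ⊆ R)
    (hN : 0 < JTnormSq x) {P : Set (Set DyadicNode)} (hP : IsNormingPartition x P)
    {S : Set DyadicNode} (hS : S ∈ P) {A : Finset DyadicNode} (hA : (A : Set DyadicNode) = S ∩ R) :
    Good x A := by
  have hev : ∀ᶠ n in Filter.atTop, trunc R n S = A := by
    obtain ⟨n, hn⟩ := (tendsto_lev.eventually (Filter.eventually_ge_atTop A)).exists
    filter_upwards [tendsto_lev.eventually (Filter.eventually_ge_atTop A)] with n hn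
    ext a
    have : a ∈ A ↔ a ∈ S ∧ a ∈ R := by
      rw [← Finset.mem_coe, hA]; rfl
    rw [mem_trunc, ← this]
    exact ⟨fun h => h.2, fun h => ⟨mem_lev.1 (hn h), h⟩⟩
  constructor
  · obtain ⟨n, hn⟩ := hev.exists
    rw [← hn]
    exact trunc_segment hR (hP.1.1 S hS) n
  · intro ε hε
    obtain ⟨I, hIP, hI⟩ := approx x hsR hN hP hε
    obtain ⟨n, hn, hnA⟩ := (hI.and hev).exists
    refine ⟨I.erase S, trunc R n, ?_, ?_, ?_, ?_⟩
    · intro i hi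
      exact trunc_segment hR (hP.1.1 i (hIP i (Finset.mem_of_mem_erase hi))) n
    · intro i hi j hj hij
      exact trunc_disjoint (hP.1.2 (hIP i (Finset.mem_of_mem_erase hi))
        (hIP j (Finset.mem_of_mem_erase hj)) hij) n
    · intro i hi
      rw [← hnA]
      exact trunc_disjoint (hP.1.2 (hIP i (Finset.mem_of_mem_erase hi)) hS
        (Finset.ne_of_mem_erase hi)) n
    · refine hn.trans ?_
      rw [← hnA]
      by_cases hSI : S ∈ I
      · rw [Finset.sum_erase_add _ _ hSI]
      · rw [Finset.erase_eq_of_notMem hSI]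
        linarith [sq_nonneg (∑ a ∈ trunc R n S, x a)]

lemma good_singleton (x : DyadicNode → ℝ) {R : Set DyadicNode} (hR : IsCompleteSubtree R)
    (hsR : Function.support x ⊆ R)
    (hN : 0 < JTnormSq x) {P : Set (Set DyadicNode)} (hP : IsNormingPartition x P)
    {a : DyadicNode} (ha : ∀ S ∈ P, a ∉ S ∩ R) : Good x {a} := by
  constructor
  · constructor
    · intro b hb c hc
      simp only [Finset.coe_singleton, Set.mem_singleton_iff] at hb hc
      subst hb; subst hc
      exact Or.inl (List.prefix_refl _)
    · intro b hb c hc d hbd hdc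
      simp only [Finset.coe_singleton, Set.mem_singleton_iff] at hb hc ⊢
      subst hb; subst hc
      exact hdc.eq_of_length (le_antisymm hdc.length_le hbd.length_le)
  · intro ε hε
    obtain ⟨I, hIP, hI⟩ := approx x hsR hN hP hε
    obtain ⟨n, hn⟩ := hI.exists
    refine ⟨I, trunc R n, ?_, ?_, ?_, ?_⟩
    · intro i hi
      exact trunc_segment hR (hP.1.1 i (hIP i hi)) n
    · intro i hi j hj hij
      exact trunc_disjoint (hP.1.2 (hIP i hi) (hIP j hj) hij) n
    · intro i hi
      rw [Finset.disjoint_singleton_right, mem_trunc]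
      exact fun h => ha i (hIP i hi) h.2
    · linarith [sq_nonneg (∑ b ∈ {a}, x b)]

open Classical in
lemma saturated_sum (x d : DyadicNode → ℝ) {R : Set DyadicNode} (hR : IsCompleteSubtree R)
    (hsR : Function.support x ⊆ R)
    (hN : 0 < JTnormSq x) {P : Set (Set DyadicNode)} (hP : IsNormingPartition x P)
    (hd : ∀ A, Good x A → ∑ a ∈ A, d a = 0) (A : Finset DyadicNode) :
    (∀ S ∈ P, ∀ u ∈ S ∩ R, u ∈ A → S ∩ R ⊆ A) → ∑ a ∈ A, d a = 0 := by
  induction A using Finset.strongInduction with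
  | H A ih =>
    intro hA
    rcases A.eq_empty_or_nonempty with rfl | ⟨a, ha⟩
    · simp
    by_cases hc : ∃ S ∈ P, a ∈ S ∩ R
    · obtain ⟨S, hS, haS⟩ := hc
      have hsub := hA S hS a haS ha
      have hfin : (S ∩ R).Finite := A.finite_toSet.subset hsub
      have hg : Good x hfin.toFinset := good_of_mem x hR hsR hN hP hS (by simp)
      have hsub' : hfin.toFinset ⊆ A := by
        intro b hb
        exact hsub (by simpa using hb)
      rw [← Finset.sum_sdiff hsub', hd _ hg, add_zero]
      apply ih
      · refine Finset.sdiff_ssubset hsub' ⟨a, ?_⟩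
        simpa using haS
      · intro S' hS' u hu huA v hv
        simp only [Finset.mem_sdiff, Set.Finite.mem_toFinset] at huA
        simp only [Finset.coe_sdiff, Set.Finite.coe_toFinset]
        refine ⟨hA S' hS' u hu huA.1 hv, fun hvS => ?_⟩
        by_cases hSS : S' = S
        · subst hSS; exact huA.2 hu
        · exact Set.disjoint_left.1 (hP.1.2 hS' hS hSS) hv.1 hvS.1
    · push Not at hc
      have hg := hd _ (good_singleton x hR hsR hN hP hc)
      rw [Finset.sum_singleton] at hg
      rw [← Finset.sum_erase_add _ _ ha, hg, add_zero]
      apply ih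
      · exact Finset.erase_ssubset ha
      · intro S' hS' u hu huA v hv
        refine Finset.mem_coe.2 (Finset.mem_erase.2 ⟨?_, ?_⟩)
        · rintro rfl; exact hc S' hS' hv
        · exact hA S' hS' u hu (Finset.mem_of_mem_erase huA) hv

lemma single_norming (x : DyadicNode → ℝ) (a : DyadicNode) (h : ∀ b, b ≠ a → x b = 0) :
    IsNormingPartition x {{a}} := by
  have hpart : IsPartition ({{a}} : Set (Set DyadicNode)) := by
    constructor
    · rintro S rfl
      constructor
      · rintro b rfl c rfl
        exact Or.inl (List.prefix_refl _)
      · rintro b rfl c rfl d hbd hdc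
        exact hdc.eq_of_length (le_antisymm hdc.length_le hbd.length_le)
    · exact Set.pairwiseDisjoint_singleton _ _
  have hseg : ∀ S : Set DyadicNode, segSum x S = S.indicator x a := by
    intro S
    have : segSum x S = ∑' b, S.indicator x b := tsum_subtype S x
    rw [this]
    refine tsum_eq_single a fun b hb => ?_
    by_cases hbS : b ∈ S <;> simp [hbS, h b hb]
  have hval : pNormSq x {{a}} = x a ^ 2 := by
    unfold pNormSq
    rw [tsum_fintype]
    simp [hseg]
  have hle : ∀ P, IsPartition P → pNormSq x P ≤ x a ^ 2 := by
    intro P hP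
    unfold pNormSq
    by_cases hc : ∃ S ∈ P, a ∈ S
    · obtain ⟨S, hS, haS⟩ := hc
      rw [tsum_eq_single (⟨S, hS⟩ : P)]
      · simp [hseg, haS]
      · rintro ⟨S', hS'⟩ hne
        have : a ∉ S' := fun h' => Set.disjoint_left.1
          (hP.2 hS' hS (fun h'' => hne (Subtype.ext h''))) h' haS
        simp [hseg, this]
    · push Not at hc
      have : ∀ S : P, (segSum x S) ^ 2 = 0 := by
        rintro ⟨S, hS⟩
        simp [hseg, hc S hS]
      simp only [this, tsum_zero]
      positivity
  refine ⟨hpart, ?_⟩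
  unfold JTnormSq
  symm
  apply IsGreatest.csSup_eq
  refine ⟨⟨_, hpart, rfl⟩, ?_⟩
  rintro r ⟨P, hP, rfl⟩
  rw [hval]
  exact hle P hP

lemma ran_complete (x : DyadicNode → ℝ) : IsCompleteSubtree (ran x) := by
  intro a ha b hb c hac hcb K hK
  exact hK.1 a (ha K hK) b (hb K hK) c hac hcb

lemma support_subset_ran (x : DyadicNode → ℝ) : Function.support x ⊆ ran x := by
  intro a ha K hK
  exact hK.2 ha

lemma exists_norming (x : DyadicNode → ℝ) (hx0 : x ≠ 0) (hsep : Separated x) :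
    ∃ P, IsNormingPartition x P := by
  obtain ⟨a, ha⟩ := Function.ne_iff.1 hx0
  have haR : a ∈ ran x := support_subset_ran x ha
  by_cases hc : ∃ b ∈ ran x, a ≠ b
  · obtain ⟨b, hb, hab⟩ := hc
    obtain ⟨P, hP, _⟩ := hsep a haR b hb hab
    exact ⟨P, hP⟩
  · push Not at hc
    refine ⟨{{a}}, single_norming x a fun b hb => ?_⟩
    by_contra hxb
    exact hb (hc b (support_subset_ran x hxb)).symm

lemma exists_cut (x : DyadicNode → ℝ) (hx0 : x ≠ 0) (hsep : Separated x) (p : DyadicNode)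
    (c : Bool) : ∃ P, IsNormingPartition x P ∧
      ∀ S ∈ P, p ∈ S ∩ ran x → p ++ [c] ∈ S ∩ ran x → False := by
  by_cases h : p ∈ ran x ∧ p ++ [c] ∈ ran x
  · obtain ⟨P, hP, S, hS, S', hS', hne, hpS, hcS⟩ := hsep p h.1 (p ++ [c]) h.2 (by simp)
    refine ⟨P, hP, fun S'' hS'' h1 h2 => ?_⟩
    have e1 : S'' = S := by
      by_contra hc
      exact Set.disjoint_left.1 (hP.1.2 hS'' hS hc) h1.1 hpS
    have e2 : S'' = S' := by
      by_contra hc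
      exact Set.disjoint_left.1 (hP.1.2 hS'' hS' hc) h2.1 hcS
    exact hne (e1.symm.trans e2)
  · obtain ⟨P, hP⟩ := exists_norming x hx0 hsep
    exact ⟨P, hP, fun S _ h1 h2 => h ⟨h1.2, h2.2⟩⟩

lemma cut_saturated {R S : Set DyadicNode} (hR : IsCompleteSubtree R) (hS : IsSegment S)
    {p : DyadicNode} {c : Bool} (hcut : p ∈ S ∩ R → p ++ [c] ∈ S ∩ R → False)
    {u v : DyadicNode} (hu : u ∈ S ∩ R) (hv : v ∈ S ∩ R) (hbu : p ++ [c] <+: u) :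
    p ++ [c] <+: v := by
  by_contra hbv
  rcases hS.1 u hu.1 v hv.1 with h | h
  · exact hbv (hbu.trans h)
  · rcases List.prefix_or_prefix_of_prefix h hbu with h1 | h1
    · rcases List.prefix_concat_iff.1 h1 with h2 | h2
      · exact hbv (h2 ▸ List.prefix_refl _)
      · have hpu : p <+: u := (List.prefix_append p [c]).trans hbu
        exact hcut ⟨hS.2 v hv.1 u hu.1 p h2 hpu, hR v hv.2 u hu.2 p h2 hpu⟩
          ⟨hS.2 v hv.1 u hu.1 _ h1 hbu, hR v hv.2 u hu.2 _ h1 hbu⟩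
    · exact hbv h1

lemma branch_down {σ : Set DyadicNode} (hσ : IsBranch σ) {a b : DyadicNode} (hb : b ∈ σ)
    (hab : a <+: b) : a ∈ σ := by
  have h := hσ.2 {c | ∃ b ∈ σ, c <+: b} ?_ (fun c hc => ⟨c, hc, List.prefix_refl _⟩)
  · rw [← h]
    exact ⟨b, hb, hab⟩
  · constructor
    · rintro u ⟨b, hb, hub⟩ v ⟨b', hb', hvb⟩
      rcases hσ.1.1 b hb b' hb' with h | h
      · exact List.prefix_or_prefix_of_prefix (hub.trans h) hvb
      · exact List.prefix_or_prefix_of_prefix hub (hvb.trans h)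
    · rintro u _ v ⟨b', hb', hvb⟩ w _ hwv
      exact ⟨b', hb', hwv.trans hvb⟩

lemma child_of_lt {a b : DyadicNode} (h : a <+: b) (hne : a ≠ b) : ∃ c, a ++ [c] <+: b := by
  obtain ⟨t, rfl⟩ := h
  cases t with
  | nil => simp at hne
  | cons c t => exact ⟨c, t, by simp⟩

lemma branch_child {σ : Set DyadicNode} (hσ : IsBranch σ) {a : DyadicNode} (ha : a ∈ σ) :
    ∃ c, a ++ [c] ∈ σ := by
  by_contra hc
  push Not at hc
  have hle : ∀ b ∈ σ, b <+: a := by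
    intro b hb
    rcases hσ.1.1 a ha b hb with h | h
    · by_cases hne : a = b
      · exact hne ▸ List.prefix_refl _
      · obtain ⟨c, h'⟩ := child_of_lt h hne
        exact absurd (branch_down hσ hb h') (hc c)
    · exact h
  have h := hσ.2 {b | b <+: a ++ [true]} ?_ (fun b hb => (hle b hb).trans (List.prefix_append _ _))
  · exact hc true (h ▸ List.prefix_refl _)
  · constructor
    · intro u hu v hv
      exact List.prefix_or_prefix_of_prefix hu hv
    · intro u _ v hv w _ hwv
      exact hwv.trans hv

lemma finite_prefixes (a : DyadicNode) : {b | b <+: a}.Finite := by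
  refine (List.finite_length_lt Bool (a.length + 1)).subset fun b hb => ?_
  have := List.IsPrefix.length_le hb
  simp only [Set.mem_setOf_eq]
  omega

lemma not_both {a b : DyadicNode} {c c' : Bool} (hne : c ≠ c') (h : a ++ [c] <+: b)
    (h' : a ++ [c'] <+: b) : False := by
  have := List.prefix_of_prefix_length_le h h' (by simp)
  have := this.eq_of_length (by simp)
  simp at this
  exact hne this

open Classical in
lemma diff_eq_zero (x d : DyadicNode → ℝ) (hx0 : x ≠ 0) (hN : 0 < JTnormSq x)
    (hsep : Separated x)
    (F : Set DyadicNode) (hF : F.Finite) (σ : Set DyadicNode) (hσ : IsBranch σ)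
    (hsupp : Function.support x ⊆ F ∪ σ)
    (hd : ∀ A, Good x A → ∑ a ∈ A, d a = 0) : ∀ a, d a = 0 := by
  have hR := ran_complete x
  have hsR := support_subset_ran x
  set G : Set DyadicNode := ⋃ b ∈ F, {c | c <+: b} with hG
  have hGfin : G.Finite := hF.biUnion fun b _ => finite_prefixes b
  have hRG : ran x ⊆ G ∪ σ := by
    refine Set.sInter_subset_of_mem ⟨?_, ?_⟩
    · intro a _ b hb c _ hcb
      rcases hb with hb | hb
      · left
        simp only [hG, Set.mem_iUnion, Set.mem_setOf_eq] at hb ⊢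
        obtain ⟨i, hi, hbi⟩ := hb
        exact ⟨i, hi, hcb.trans hbi⟩
      · right
        exact branch_down hσ hb hcb
    · refine hsupp.trans (Set.union_subset_union_left _ fun b hb => ?_)
      simp only [hG, Set.mem_iUnion, Set.mem_setOf_eq]
      exact ⟨b, hb, List.prefix_refl _⟩
  -- below a node off the branch
  have hfin1 : ∀ b, b ∉ σ → {u | u ∈ ran x ∧ b <+: u}.Finite := by
    intro b hb
    refine hGfin.subset ?_
    rintro u ⟨hu, hbu⟩
    rcases hRG hu with h | h
    · exact h
    · exact absurd (branch_down hσ h hbu) hb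
  have hfin2 : ∀ b, b ∈ σ → {u | u ∈ ran x ∧ ¬ b <+: u}.Finite := by
    intro b hb
    refine (hGfin.union (finite_prefixes b)).subset ?_
    rintro u ⟨hu, hbu⟩
    rcases hRG hu with h | h
    · exact Or.inl h
    · rcases hσ.1.1 b hb u h with h' | h'
      · exact absurd h' hbu
      · exact Or.inr h'
  have hsum1 : ∀ p c (h : p ++ [c] ∉ σ), ∑ a ∈ (hfin1 _ h).toFinset, d a = 0 := by
    intro p c h
    obtain ⟨P, hP, hcut⟩ := exists_cut x hx0 hsep p c
    refine saturated_sum x d hR hsR hN hP hd _ ?_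
    intro S hS u hu huA v hv
    simp only [Set.Finite.mem_toFinset, Set.Finite.coe_toFinset, Set.mem_setOf_eq] at huA ⊢
    exact ⟨hv.2, cut_saturated hR (hP.1.1 S hS) (hcut S hS) hu hv huA.2⟩
  have hsum2 : ∀ p (h : p ∈ σ), ∑ a ∈ (hfin2 p h).toFinset, d a = 0 := by
    intro p
    induction p using List.reverseRecOn with
    | nil => intro h; simp
    | append_singleton p c _ =>
      intro h
      obtain ⟨P, hP, hcut⟩ := exists_cut x hx0 hsep p c
      refine saturated_sum x d hR hsR hN hP hd _ ?_
      intro S hS u hu huA v hv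
      simp only [Set.Finite.mem_toFinset, Set.Finite.coe_toFinset, Set.mem_setOf_eq] at huA ⊢
      exact ⟨hv.2, fun hbv => huA.2 (cut_saturated hR (hP.1.1 S hS) (hcut S hS) hv hu hbv)⟩
  intro a
  by_cases haR : a ∈ ran x
  swap
  · obtain ⟨P, hP⟩ := exists_norming x hx0 hsep
    have := hd _ (good_singleton x hR hsR hN hP (a := a) fun S _ h => haR h.2)
    simpa using this
  by_cases haσ : a ∈ σ
  · obtain ⟨c, hc⟩ := branch_child hσ haσ
    have hc' : a ++ [!c] ∉ σ := by
      intro h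
      rcases hσ.1.1 _ hc _ h with h' | h'
      · exact not_both (a := a) (c := c) (c' := !c) (by cases c <;> simp) h' (List.prefix_refl _)
      · exact not_both (a := a) (c := c) (c' := !c) (by cases c <;> simp) (List.prefix_refl _) h'
    have e : (hfin2 _ hc).toFinset =
        insert a ((hfin2 a haσ).toFinset ∪ (hfin1 _ hc').toFinset) := by
      ext u
      simp only [Set.Finite.mem_toFinset, Set.mem_setOf_eq, Finset.mem_insert, Finset.mem_union]
      constructor
      · rintro ⟨h1, h2⟩
        by_cases hau : a <+: u
        · by_cases hne : a = u
          · exact Or.inl hne.symm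
          · obtain ⟨k, hk⟩ := child_of_lt hau hne
            have : k = !c := by
              by_contra hkc
              have : k = c := by cases k <;> cases c <;> simp_all
              exact h2 (this ▸ hk)
            exact Or.inr (Or.inr ⟨h1, this ▸ hk⟩)
        · exact Or.inr (Or.inl ⟨h1, hau⟩)
      · rintro (rfl | ⟨h1, h2⟩ | ⟨h1, h2⟩)
        · exact ⟨haR, fun h => by simpa using h.length_le⟩
        · exact ⟨h1, fun h => h2 ((List.prefix_append _ _).trans h)⟩
        · exact ⟨h1, fun h => not_both (by cases c <;> simp) h h2⟩
    have h0 := hsum2 _ hc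
    rw [e, Finset.sum_insert, Finset.sum_union, hsum2 a haσ, hsum1 _ _ hc'] at h0
    · simpa using h0
    · rw [Finset.disjoint_left]
      intro u hu hu'
      simp only [Set.Finite.mem_toFinset, Set.mem_setOf_eq] at hu hu'
      exact hu.2 ((List.prefix_append _ _).trans hu'.2)
    · simp only [Set.Finite.mem_toFinset, Set.mem_setOf_eq, Finset.mem_union]
      rintro (⟨_, h⟩ | ⟨_, h⟩)
      · exact h (List.prefix_refl _)
      · simpa using h.length_le
  · have hc : ∀ c, a ++ [c] ∉ σ := fun c h => haσ (branch_down hσ h (List.prefix_append _ _))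
    have e : (hfin1 _ haσ).toFinset =
        insert a ((hfin1 _ (hc true)).toFinset ∪ (hfin1 _ (hc false)).toFinset) := by
      ext u
      simp only [Set.Finite.mem_toFinset, Set.mem_setOf_eq, Finset.mem_insert, Finset.mem_union]
      constructor
      · rintro ⟨h1, hau⟩
        by_cases hne : a = u
        · exact Or.inl hne.symm
        · obtain ⟨k, hk⟩ := child_of_lt hau hne
          cases k
          · exact Or.inr (Or.inr ⟨h1, hk⟩)
          · exact Or.inr (Or.inl ⟨h1, hk⟩)
      · rintro (rfl | ⟨h1, h2⟩ | ⟨h1, h2⟩)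
        · exact ⟨haR, List.prefix_refl _⟩
        · exact ⟨h1, (List.prefix_append _ _).trans h2⟩
        · exact ⟨h1, (List.prefix_append _ _).trans h2⟩
    have h0 : ∑ a ∈ (hfin1 _ haσ).toFinset, d a = 0 := by
      rcases List.eq_nil_or_concat a with h | ⟨p, k, h⟩
      · obtain ⟨b, hb⟩ : σ.Nonempty := by
          by_contra hemp
          rw [Set.not_nonempty_iff_eq_empty] at hemp
          have := hσ.2 {[]} ⟨by simp, by
            rintro b rfl c rfl w _ hw
            simpa using hw⟩ (by simp [hemp])
          rw [hemp] at this
          simp at this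
        exact absurd (branch_down hσ hb (h ▸ List.nil_prefix)) haσ
      · simp only [List.concat_eq_append] at h
        subst h
        exact hsum1 p k haσ
    rw [e, Finset.sum_insert, Finset.sum_union, hsum1 _ _ (hc true), hsum1 _ _ (hc false)] at h0
    · simpa using h0
    · rw [Finset.disjoint_left]
      intro u hu hu'
      simp only [Set.Finite.mem_toFinset, Set.mem_setOf_eq] at hu hu'
      exact not_both (by simp) hu.2 hu'.2
    · simp only [Set.Finite.mem_toFinset, Set.mem_setOf_eq, Finset.mem_union]
      rintro (⟨_, h⟩ | ⟨_, h⟩)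
      · simpa using h.length_le
      · simpa using h.length_le

lemma JTnormSq_nonneg (x : DyadicNode → ℝ) : 0 ≤ JTnormSq x := by
  refine Real.sSup_nonneg ?_
  rintro r ⟨P, _, rfl⟩
  exact tsum_nonneg fun S => sq_nonneg _

lemma JTnormSq_pos (x : DyadicNode → ℝ) (hx : HasBddNorm x) (hx0 : x ≠ 0) : 0 < JTnormSq x := by
  obtain ⟨a, ha⟩ := Function.ne_iff.1 hx0
  have := finite_family_le x hx ({()} : Finset Unit) (fun _ => {a}) ?_ ?_
  · simp only [Finset.sum_singleton] at this
    have h2 : 0 < x a ^ 2 := by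
      have : x a ≠ 0 := ha
      positivity
    linarith
  · intro _ _
    constructor
    · intro b hb c hc
      simp only [Finset.coe_singleton, Set.mem_singleton_iff] at hb hc
      subst hb; subst hc
      exact Or.inl (List.prefix_refl _)
    · intro b hb c hc d hbd hdc
      simp only [Finset.coe_singleton, Set.mem_singleton_iff] at hb hc ⊢
      subst hb; subst hc
      exact hdc.eq_of_length (le_antisymm hdc.length_le hbd.length_le)
  · simp

/-- If `x ∈ JT` is separated and `supp x ⊆ F ∪ σ` with `F` finite and `σ`
a branch, then `x` is an extreme point of the ball of radius `‖x‖_{JT}`. -/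
theorem finite_union_branch_extreme (x : DyadicNode → ℝ) (hx : MemJT x) (hx0 : x ≠ 0)
    (hsep : Separated x)
    (F : Set DyadicNode) (hF : F.Finite) (σ : Set DyadicNode) (hσ : IsBranch σ)
    (hsupp : Function.support x ⊆ F ∪ σ) :
    IsExtremePoint x := by
  refine ⟨hx0, fun y z hy hz l hl0 hl1 hxyz hyx hzx => ?_⟩
  have hyx' : JTnormSq y = JTnormSq x :=
    (Real.sqrt_inj (JTnormSq_nonneg y) (JTnormSq_nonneg x)).1 hyx
  have hzx' : JTnormSq z = JTnormSq x :=
    (Real.sqrt_inj (JTnormSq_nonneg z) (JTnormSq_nonneg x)).1 hzx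
  have h := diff_eq_zero x (fun a => y a - z a) hx0 (JTnormSq_pos x hx.1 hx0) hsep F hF σ hσ hsupp
    (fun A hA => hA.sum_eq_zero hy.1 hz.1 hl0 hl1 hxyz hyx' hzx')
  have hyz : y = z := funext fun a => sub_eq_zero.1 (h a)
  subst hyz
  have : x = y := by
    rw [hxyz, ← add_smul]
    simp
  exact ⟨this.symm, this.symm⟩

end JTSpace
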